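/- Let 𝒜 be a finite affine hyperplane arrangement in ℝ^d, F ∈ 𝓕(𝒜) a face, C a chamber with F > C, and C̄ any chamber. Then the concatenation of any positive minimal path in Γ(𝒜) from C̄ to C̄_F with any positive minimal path from C̄_F to C is a positive minimal path from C̄ to C; equivalently, the minimal positive path length from C̄ to C equals the sum of the minimal positive path lengths from C̄ to C̄_F and from C̄_F to C. -/

import Mathlib

open CategoryTheory

attribute [local instance] Classical.propDecidable

noncomputable section

/-! ### Hyperplane arrangements -/

/-- `H` is an affine hyperplane in `ℝ^d`. -/
def IsHyperplane {d : ℕ} (H : Set (Fin d → ℝ)) : Prop :=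
  ∃ (a : Fin d → ℝ) (b : ℝ), a ≠ 0 ∧ H = {x | ∑ i, a i * x i = b}

/-- A finite affine hyperplane arrangement. -/
def IsArrangement {d : ℕ} (𝒜 : Finset (Set (Fin d → ℝ))) : Prop :=
  ∀ H ∈ 𝒜, IsHyperplane H

/-- The union of the hyperplanes of the arrangement. -/
def ArrUnion {d : ℕ} (𝒜 : Finset (Set (Fin d → ℝ))) : Set (Fin d → ℝ) :=
  ⋃ H ∈ 𝒜, (H : Set (Fin d → ℝ))

/-- `x` and `y` lie on the same side of `H` (same connected component of the complement). -/
def SameSide {d : ℕ} (H : Set (Fin d → ℝ)) (x y : Fin d → ℝ) : Prop :=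
  connectedComponentIn Hᶜ x = connectedComponentIn Hᶜ y

/-- The (relatively open) stratum of the point `x`: all points lying on exactly the same
hyperplanes as `x` and on the same side of all other hyperplanes. -/
def faceOf {d : ℕ} (𝒜 : Finset (Set (Fin d → ℝ))) (x : Fin d → ℝ) : Set (Fin d → ℝ) :=
  {y | ∀ H ∈ 𝒜, (x ∈ H ↔ y ∈ H) ∧ (x ∉ H → SameSide H x y)}

/-- The faces of the arrangement: the relatively open strata of the stratification of `ℝ^d`
induced by `𝒜`. -/
def Faces {d : ℕ} (𝒜 : Finset (Set (Fin d → ℝ))) : Set (Set (Fin d → ℝ)) :=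
  {F | ∃ x, F = faceOf 𝒜 x}

/-- A chamber: a connected component of the complement of the arrangement. -/
def IsChamber {d : ℕ} (𝒜 : Finset (Set (Fin d → ℝ))) (C : Set (Fin d → ℝ)) : Prop :=
  ∃ x, x ∉ ArrUnion 𝒜 ∧ C = connectedComponentIn (ArrUnion 𝒜)ᶜ x

/-- The order of the face poset: `F₁ ≥ F₂` iff `closure F₁ ⊆ closure F₂`. -/
def FaceGE {d : ℕ} (F₁ F₂ : Set (Fin d → ℝ)) : Prop :=
  closure F₁ ⊆ closure F₂

/-- Strict version of the face-poset order. -/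
def FaceGT {d : ℕ} (F₁ F₂ : Set (Fin d → ℝ)) : Prop :=
  FaceGE F₁ F₂ ∧ F₁ ≠ F₂

/-- The characterizing property of the composition `F ∘ P` of two faces: `Q` contains all
points `x + ε (y - x)`, for `x ∈ F`, `y ∈ P` and all sufficiently small `ε > 0`. -/
def CompProp {d : ℕ} (F P Q : Set (Fin d → ℝ)) : Prop :=
  ∀ x ∈ F, ∀ y ∈ P, ∃ ε₀ > (0 : ℝ), ∀ ε : ℝ, 0 < ε → ε < ε₀ → x + ε • (y - x) ∈ Q

/-- The composition `F ∘ P` of two faces: the unique face `Q` satisfying `CompProp F P Q`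
(junk value `∅` if no unique such face exists). -/
def faceComp {d : ℕ} (𝒜 : Finset (Set (Fin d → ℝ))) (F P : Set (Fin d → ℝ)) :
    Set (Fin d → ℝ) :=
  if h : ∃! Q, Q ∈ Faces 𝒜 ∧ CompProp F P Q then h.choose else ∅

/-- `H` separates the (chambers) `A` and `B`. -/
def Separates {d : ℕ} (H A B : Set (Fin d → ℝ)) : Prop :=
  ∃ x ∈ A, ∃ y ∈ B, x ∉ H ∧ y ∉ H ∧ ¬ SameSide H x y

/-- Two chambers are adjacent if exactly one hyperplane of `𝒜` separates them. -/
def Adjacent {d : ℕ} (𝒜 : Finset (Set (Fin d → ℝ))) (A B : Set (Fin d → ℝ)) : Prop :=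
  ∃! H, H ∈ 𝒜 ∧ Separates H A B

/-! ### Oriented graphs and walks -/

/-- An oriented graph: vertices, edges, source and target maps. -/
structure OrientedGraph : Type 1 where
  V : Type
  E : Type
  src : E → V
  tgt : E → V

namespace OrientedGraph

variable (G : OrientedGraph)

/-- Start vertex of a signed edge (an edge traversed forwards (`true`) or backwards). -/
def stepSrc : G.E × Bool → G.V
  | (e, true) => G.src e
  | (e, false) => G.tgt e

/-- End vertex of a signed edge. -/
def stepTgt : G.E × Bool → G.V
  | (e, true) => G.tgt e
  | (e, false) => G.src e

/-- The list of signed edges `l` forms a walk starting at `v`. -/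
def WalkFrom : G.V → List (G.E × Bool) → Prop
  | _, [] => True
  | v, s :: l => G.stepSrc s = v ∧ WalkFrom (G.stepTgt s) l

/-- The final vertex of a walk. -/
def walkEnd : G.V → List (G.E × Bool) → G.V
  | v, [] => v
  | _, s :: l => walkEnd (G.stepTgt s) l

/-- The list of vertices visited by a walk. -/
def visits : G.V → List (G.E × Bool) → List G.V
  | v, [] => [v]
  | v, s :: l => v :: visits (G.stepTgt s) l

theorem walkEnd_append : ∀ (l₁ l₂ : List (G.E × Bool)) (v : G.V),
    G.walkEnd v (l₁ ++ l₂) = G.walkEnd (G.walkEnd v l₁) l₂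
  | [], _, _ => rfl
  | s :: l₁, l₂, _ => walkEnd_append l₁ l₂ (G.stepTgt s)

theorem walkFrom_append : ∀ (l₁ l₂ : List (G.E × Bool)) (v : G.V),
    G.WalkFrom v l₁ → G.WalkFrom (G.walkEnd v l₁) l₂ → G.WalkFrom v (l₁ ++ l₂)
  | [], _, _, _, h₂ => h₂
  | _ :: l₁, l₂, _, h₁, h₂ => ⟨h₁.1, walkFrom_append l₁ l₂ _ h₁.2 h₂⟩

/-- Reversal of a signed edge. -/
def flipStep (s : G.E × Bool) : G.E × Bool := (s.1, !s.2)

theorem stepSrc_flip (s : G.E × Bool) : G.stepSrc (G.flipStep s) = G.stepTgt s := by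
  rcases s with ⟨e, _ | _⟩ <;> rfl

theorem stepTgt_flip (s : G.E × Bool) : G.stepTgt (G.flipStep s) = G.stepSrc s := by
  rcases s with ⟨e, _ | _⟩ <;> rfl

/-- The list of signed edges of the inverse walk. -/
def invList (l : List (G.E × Bool)) : List (G.E × Bool) := (l.map G.flipStep).reverse

theorem invList_cons (s : G.E × Bool) (l : List (G.E × Bool)) :
    G.invList (s :: l) = G.invList l ++ [G.flipStep s] := by
  simp [invList]

theorem walkEnd_inv : ∀ (l : List (G.E × Bool)) (v : G.V), G.WalkFrom v l →
    G.walkEnd (G.walkEnd v l) (G.invList l) = v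
  | [], _, _ => rfl
  | s :: l, v, h => by
      rw [show G.walkEnd v (s :: l) = G.walkEnd (G.stepTgt s) l from rfl,
        G.invList_cons, G.walkEnd_append, walkEnd_inv l _ h.2]
      show G.stepTgt (G.flipStep s) = v
      rw [G.stepTgt_flip]; exact h.1

theorem walkFrom_inv : ∀ (l : List (G.E × Bool)) (v : G.V), G.WalkFrom v l →
    G.WalkFrom (G.walkEnd v l) (G.invList l)
  | [], _, _ => trivial
  | s :: l, v, h => by
      rw [show G.walkEnd v (s :: l) = G.walkEnd (G.stepTgt s) l from rfl, G.invList_cons]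
      refine G.walkFrom_append _ _ _ (walkFrom_inv l _ h.2) ?_
      rw [G.walkEnd_inv l _ h.2]
      exact ⟨G.stepSrc_flip s, trivial⟩

end OrientedGraph

/-- A walk in an oriented graph: a start vertex and a composable list of signed edges. -/
structure GWalk (G : OrientedGraph) where
  start : G.V
  steps : List (G.E × Bool)
  valid : G.WalkFrom start steps

namespace GWalk

variable {G : OrientedGraph}

/-- The end vertex of a walk. -/
def endV (w : GWalk G) : G.V := G.walkEnd w.start w.steps

/-- The length of a walk. -/
def length (w : GWalk G) : ℕ := w.steps.length

/-- A walk is positive if all its edges are traversed forwards. -/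
def Positive (w : GWalk G) : Prop := ∀ s ∈ w.steps, s.2 = true

/-- The vertices visited by a walk. -/
def vertices (w : GWalk G) : List G.V := G.visits w.start w.steps

/-- The constant walk at a vertex. -/
def nil (G : OrientedGraph) (v : G.V) : GWalk G := ⟨v, [], trivial⟩

/-- Concatenation of walks (junk value `w₁` if the endpoints do not match). -/
def append' (w₁ w₂ : GWalk G) : GWalk G :=
  if h : w₁.endV = w₂.start then
    ⟨w₁.start, w₁.steps ++ w₂.steps,
      G.walkFrom_append _ _ _ w₁.valid
        (by rw [show G.walkEnd w₁.start w₁.steps = w₂.start from h]; exact w₂.valid)⟩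
  else w₁

/-- The inverse walk. -/
def inv (w : GWalk G) : GWalk G := ⟨w.endV, G.invList w.steps, G.walkFrom_inv _ _ w.valid⟩

end GWalk

/-- A morphism of oriented graphs. -/
structure GraphMor (G H : OrientedGraph) where
  onV : G.V → H.V
  onE : G.E → H.E
  src_comm : ∀ e, H.src (onE e) = onV (G.src e)
  tgt_comm : ∀ e, H.tgt (onE e) = onV (G.tgt e)

namespace GraphMor

variable {G H : OrientedGraph} (ρ : GraphMor G H)

/-- Image of a signed edge. -/
def mapStep (s : G.E × Bool) : H.E × Bool := (ρ.onE s.1, s.2)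

theorem stepSrc_map (s : G.E × Bool) :
    H.stepSrc (ρ.mapStep s) = ρ.onV (G.stepSrc s) := by
  rcases s with ⟨e, _ | _⟩
  · exact ρ.tgt_comm e
  · exact ρ.src_comm e

theorem stepTgt_map (s : G.E × Bool) :
    H.stepTgt (ρ.mapStep s) = ρ.onV (G.stepTgt s) := by
  rcases s with ⟨e, _ | _⟩
  · exact ρ.src_comm e
  · exact ρ.tgt_comm e

theorem walkFrom_map : ∀ (l : List (G.E × Bool)) (v : G.V),
    G.WalkFrom v l → H.WalkFrom (ρ.onV v) (l.map ρ.mapStep)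
  | [], _, _ => trivial
  | s :: l, v, h => by
      refine ⟨?_, ?_⟩
      · rw [ρ.stepSrc_map, h.1]
      · rw [ρ.stepTgt_map]
        exact walkFrom_map l _ h.2

theorem walkEnd_map : ∀ (l : List (G.E × Bool)) (v : G.V),
    H.walkEnd (ρ.onV v) (l.map ρ.mapStep) = ρ.onV (G.walkEnd v l)
  | [], _ => rfl
  | s :: l, v => by
      show H.walkEnd (H.stepTgt (ρ.mapStep s)) (l.map ρ.mapStep) = _
      rw [ρ.stepTgt_map]
      exact walkEnd_map l _

/-- Image of a walk under a morphism of oriented graphs. -/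
def mapWalk (w : GWalk G) : GWalk H :=
  ⟨ρ.onV w.start, w.steps.map ρ.mapStep, ρ.walkFrom_map _ _ w.valid⟩

theorem mapWalk_start (w : GWalk G) : (ρ.mapWalk w).start = ρ.onV w.start := rfl

theorem mapWalk_endV (w : GWalk G) : (ρ.mapWalk w).endV = ρ.onV w.endV :=
  ρ.walkEnd_map _ _

end GraphMor

/-- A positive walk of minimal length among the positive walks with the same endpoints. -/
def IsMinPos (G : OrientedGraph) (w : GWalk G) : Prop :=
  w.Positive ∧ ∀ w' : GWalk G, w'.start = w.start → w'.endV = w.endV → w'.Positive →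
    w.length ≤ w'.length

/-- An oriented system: an oriented graph together with an equivalence relation on its
walks which is endpoint-preserving, cancellative and compatible with composition. -/
structure OrientedSystem (G : OrientedGraph) where
  rel : GWalk G → GWalk G → Prop
  rel_start : ∀ {α β}, rel α β → α.start = β.start
  rel_endV : ∀ {α β}, rel α β → α.endV = β.endV
  rel_refl : ∀ α, rel α α
  rel_symm : ∀ {α β}, rel α β → rel β α
  rel_trans : ∀ {α β γ}, rel α β → rel β γ → rel α γ
  rel_cancel : ∀ α : GWalk G, rel (α.append' α.inv) (GWalk.nil G α.start)
  rel_inv : ∀ {α β}, rel α β → rel α.inv β.inv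
  rel_comp : ∀ {α β : GWalk G} (γ₁ γ₂ : GWalk G), rel α β →
      γ₁.endV = α.start → α.endV = γ₂.start →
      rel ((γ₁.append' α).append' γ₂) ((γ₁.append' β).append' γ₂)

/-- The oriented system of an arrangement: the smallest oriented-system relation
identifying any two positive minimal walks with the same begin and end. -/
def IsMinimalSystem (G : OrientedGraph) (S : OrientedSystem G) : Prop :=
  (∀ α β : GWalk G, α.start = β.start → α.endV = β.endV →
      IsMinPos G α → IsMinPos G β → S.rel α β) ∧
  ∀ S' : OrientedSystem G,
    (∀ α β : GWalk G, α.start = β.start → α.endV = β.endV →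
        IsMinPos G α → IsMinPos G β → S'.rel α β) →
    ∀ α β, S.rel α β → S'.rel α β

/-- A cover of oriented systems: unique path lifting, preserving the identifications. -/
structure IsCoverOS {Θ Γ : OrientedGraph} (ρ : GraphMor Θ Γ)
    (SΘ : OrientedSystem Θ) (SΓ : OrientedSystem Γ) : Prop where
  lift_exists_unique : ∀ (v : Θ.V) (α : GWalk Γ), α.start = ρ.onV v →
    ∃! α' : GWalk Θ, α'.start = v ∧ ρ.mapWalk α' = α
  lift_rel : ∀ (v : Θ.V) (α β : GWalk Γ), α.start = ρ.onV v → β.start = ρ.onV v →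
    SΓ.rel α β → ∀ α' β' : GWalk Θ, α'.start = v → β'.start = v →
    ρ.mapWalk α' = α → ρ.mapWalk β' = β → SΘ.rel α' β'

/-- A connected oriented graph. -/
def GConnected (G : OrientedGraph) : Prop :=
  Nonempty G.V ∧ ∀ a b : G.V, ∃ w : GWalk G, w.start = a ∧ w.endV = b

/-! ### The graph of chambers of an arrangement -/

/-- The oriented graph `Γ(𝒜)`: vertices are the chambers, with a directed edge in each
direction between each pair of adjacent chambers. -/
def chamberGraph {d : ℕ} (𝒜 : Finset (Set (Fin d → ℝ))) : OrientedGraph where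
  V := {C : Set (Fin d → ℝ) // IsChamber 𝒜 C}
  E := {p : {C : Set (Fin d → ℝ) // IsChamber 𝒜 C} × {C : Set (Fin d → ℝ) // IsChamber 𝒜 C} //
    Adjacent 𝒜 p.1.1 p.2.1}
  src := fun e => e.1.1
  tgt := fun e => e.1.2

/-- The end vertex of the lift at `v` of a positive minimal walk from `ρ(v)` to `b`
(junk value `v` if no such lift exists). -/
def liftEnd {d : ℕ} {𝒜 : Finset (Set (Fin d → ℝ))} {Θ : OrientedGraph}
    (ρ : GraphMor Θ (chamberGraph 𝒜)) (v : Θ.V) (b : (chamberGraph 𝒜).V) : Θ.V :=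
  if h : ∃ γ : GWalk Θ, γ.start = v ∧ IsMinPos (chamberGraph 𝒜) (ρ.mapWalk γ) ∧
      (ρ.mapWalk γ).endV = b then
    h.choose.endV
  else v

/-! ### The poset limits of the diagrams -/

/-- Elements of the poset limit `Plim 𝒟_id`: pairs `(F, C)` with `F` a face, `C` a chamber
and `F > C`. -/
def PlimIdMem {d : ℕ} (𝒜 : Finset (Set (Fin d → ℝ)))
    (p : Set (Fin d → ℝ) × Set (Fin d → ℝ)) : Prop :=
  p.1 ∈ Faces 𝒜 ∧ IsChamber 𝒜 p.2 ∧ FaceGT p.1 p.2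

/-- The order of the poset limit `Plim 𝒟_id`:
`(F₁, C₁) ≥ (F₂, C₂)` iff `F₁ ≥ F₂` and `C₂ = (C₁)_{F₂}` (with `C₂ = C₁` when `F₁ = F₂`). -/
def PlimIdGE {d : ℕ} (𝒜 : Finset (Set (Fin d → ℝ)))
    (p q : Set (Fin d → ℝ) × Set (Fin d → ℝ)) : Prop :=
  FaceGE p.1 q.1 ∧
    ((p.1 = q.1 ∧ p.2 = q.2) ∨ (p.1 ≠ q.1 ∧ q.2 = faceComp 𝒜 q.1 p.2))

/-- Elements of the poset limit `Plim 𝒟_ρ`: pairs `(F, v)` with `F` a face, `v` a vertex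
of `Θ` and `F > ρ(v)`. -/
def PlimRhoMem {d : ℕ} (𝒜 : Finset (Set (Fin d → ℝ))) {Θ : OrientedGraph}
    (ρ : GraphMor Θ (chamberGraph 𝒜)) (p : Set (Fin d → ℝ) × Θ.V) : Prop :=
  p.1 ∈ Faces 𝒜 ∧ FaceGT p.1 (ρ.onV p.2).1

/-- The order of the poset limit `Plim 𝒟_ρ`: `(F₁, v₁) ≥ (F₂, v₂)` iff `F₁ ≥ F₂` and
`v₂ = end(γ̂_{v₁}(ρ(v₁) → ρ(v₁)_{F₂}))` (with `v₂ = v₁` when `F₁ = F₂`). -/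
def PlimRhoGE {d : ℕ} (𝒜 : Finset (Set (Fin d → ℝ))) {Θ : OrientedGraph}
    (ρ : GraphMor Θ (chamberGraph 𝒜)) (p q : Set (Fin d → ℝ) × Θ.V) : Prop :=
  FaceGE p.1 q.1 ∧
    ((p.1 = q.1 ∧ p.2 = q.2) ∨
      (p.1 ≠ q.1 ∧ ∃ h : IsChamber 𝒜 (faceComp 𝒜 q.1 (ρ.onV p.2).1),
        q.2 = liftEnd ρ p.2 ⟨faceComp 𝒜 q.1 (ρ.onV p.2).1, h⟩))

/-! ### Geometric realization of order complexes -/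

/-- The geometric realization of the order complex of the relation `r` on the set of
elements satisfying `S`: convex combinations (in `P → ℝ`, with the product topology)
whose supports are finite chains of elements satisfying `S`. -/
def ocg {P : Type} (S : P → Prop) (r : P → P → Prop) : Set (P → ℝ) :=
  {f | (∀ p, 0 ≤ f p) ∧
       (∃ s : Finset P, (∀ p ∉ s, f p = 0) ∧ ∑ p ∈ s, f p = 1) ∧
       (∀ p, f p ≠ 0 → S p) ∧
       IsChain r {p | f p ≠ 0}}

/-- The vertex of the realization of an order complex corresponding to `p₀`. -/
def vtx {P : Type} (p₀ : P) : P → ℝ := fun p => if p = p₀ then 1 else 0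

theorem vtx_mem {P : Type} {S : P → Prop} {r : P → P → Prop} {p₀ : P} (h : S p₀) :
    vtx p₀ ∈ ocg S r := by
  have hsupp : ∀ p : P, vtx p₀ p ≠ 0 → p = p₀ := by
    intro p hp
    by_contra h'
    exact hp (if_neg h')
  refine ⟨?_, ⟨{p₀}, ?_, ?_⟩, ?_, ?_⟩
  · intro p
    unfold vtx
    split <;> norm_num
  · intro p hp
    exact if_neg (by simpa using hp)
  · simp [vtx]
  · intro p hp
    rwa [hsupp p hp]
  · intro a ha b hb hab
    exact absurd ((hsupp a ha).trans (hsupp b hb).symm) hab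

/-- Pushforward of weights along a map of vertex sets: the simplicial map induced on
realizations of order complexes. -/
def pushf {P Q : Type} (g : P → Q) (f : P → ℝ) : Q → ℝ :=
  fun q => ∑ᶠ p ∈ g ⁻¹' {q}, f p

/-! ### The fundamental group of an oriented graph -/

/-- The vertices of `G`, as a quiver. -/
abbrev QV (G : OrientedGraph) : Type := G.V

instance (G : OrientedGraph) : Quiver (QV G) :=
  ⟨fun a b => {e : G.E // G.src e = a ∧ G.tgt e = b}⟩

/-- The class, in the free groupoid on the graph `G`, of a walk. -/
def walkHom (G : OrientedGraph) : (v : G.V) → (l : List (G.E × Bool)) → G.WalkFrom v l →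
    ((Quiver.FreeGroupoid.of (QV G)).obj v ⟶ (Quiver.FreeGroupoid.of (QV G)).obj (G.walkEnd v l))
  | _, [], _ => 𝟙 _
  | v, (e, true) :: l, h =>
      eqToHom (congrArg (Quiver.FreeGroupoid.of (QV G)).obj h.1.symm) ≫
        ((Quiver.FreeGroupoid.of (QV G)).map (X := G.src e) (Y := G.tgt e) ⟨e, rfl, rfl⟩ ≫
          walkHom G _ l h.2)
  | v, (e, false) :: l, h =>
      eqToHom (congrArg (Quiver.FreeGroupoid.of (QV G)).obj h.1.symm) ≫
        (Groupoid.inv ((Quiver.FreeGroupoid.of (QV G)).map (X := G.src e) (Y := G.tgt e) ⟨e, rfl, rfl⟩) ≫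
          walkHom G _ l h.2)

/-- The class of a walk in the free groupoid on the graph. -/
def GWalk.toHom {G : OrientedGraph} (w : GWalk G) :
    ((Quiver.FreeGroupoid.of (QV G)).obj w.start ⟶ (Quiver.FreeGroupoid.of (QV G)).obj w.endV) :=
  walkHom G w.start w.steps w.valid

/-- The fundamental group `π₁` of the graph `G` based at `v`: the vertex group of the free
groupoid on `G`. -/
abbrev Pi1 (G : OrientedGraph) (v : G.V) : Type :=
  ((Quiver.FreeGroupoid.of (QV G)).obj v ⟶ (Quiver.FreeGroupoid.of (QV G)).obj v)

/-- The class in `π₁(G, v₀)` of the loop `δ γ₁ γ₂⁻¹ δ⁻¹`, where `γ₁, γ₂` have common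
endpoints and `δ` is a base path from `v₀`. -/
def loopClass {G : OrientedGraph} {v₀ : G.V} (δ γ₁ γ₂ : GWalk G)
    (hδs : δ.start = v₀) (hδe : δ.endV = γ₁.start)
    (hs : γ₁.start = γ₂.start) (he : γ₁.endV = γ₂.endV) : Pi1 G v₀ :=
  eqToHom (congrArg (Quiver.FreeGroupoid.of (QV G)).obj hδs.symm) ≫ δ.toHom ≫
    eqToHom (congrArg (Quiver.FreeGroupoid.of (QV G)).obj hδe) ≫ γ₁.toHom ≫
    eqToHom (congrArg (Quiver.FreeGroupoid.of (QV G)).obj he) ≫ Groupoid.inv γ₂.toHom ≫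
    eqToHom (congrArg (Quiver.FreeGroupoid.of (QV G)).obj (hs.symm.trans hδe.symm)) ≫
    Groupoid.inv δ.toHom ≫ eqToHom (congrArg (Quiver.FreeGroupoid.of (QV G)).obj hδs)

/-- The set of classes of loops `γ₁ γ₂⁻¹` with `ρ(γ₁) ∼ ρ(γ₂)`, transported to the base
vertex `v₀` via the fixed base paths `δ`. -/
def SigmaSet {Θ Γ : OrientedGraph} (ρ : GraphMor Θ Γ) (SΓ : OrientedSystem Γ)
    (v₀ : Θ.V) (δ : Θ.V → GWalk Θ) : Set (Pi1 Θ v₀) :=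
  {g | ∃ (γ₁ γ₂ : GWalk Θ) (hδs : (δ γ₁.start).start = v₀)
      (hδe : (δ γ₁.start).endV = γ₁.start)
      (hs : γ₁.start = γ₂.start) (he : γ₁.endV = γ₂.endV),
      SΓ.rel (ρ.mapWalk γ₁) (ρ.mapWalk γ₂) ∧
      g = loopClass (δ γ₁.start) γ₁ γ₂ hδs hδe hs he}



/-! ### Helpers -/

/-- `g` gives defining affine functions for the hyperplanes of `𝒜`. -/
def DefFun {d : ℕ} (𝒜 : Finset (Set (Fin d → ℝ)))
    (g : Set (Fin d → ℝ) → ((Fin d → ℝ) →ᵃ[ℝ] ℝ)) : Prop :=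
  ∀ H ∈ 𝒜, ∀ x, x ∈ H ↔ g H x = 0

theorem exists_defFun {d : ℕ} (𝒜 : Finset (Set (Fin d → ℝ))) (h : IsArrangement 𝒜) :
    ∃ g, DefFun 𝒜 g := by
  have : ∀ H : Set (Fin d → ℝ), ∃ f : (Fin d → ℝ) →ᵃ[ℝ] ℝ, H ∈ 𝒜 → ∀ x, x ∈ H ↔ f x = 0 := by
    intro H
    by_cases hH : H ∈ 𝒜
    · obtain ⟨a, b, -, rfl⟩ := h H hH
      refine ⟨(Fintype.linearCombination ℝ a).toAffineMap - AffineMap.const ℝ _ b, fun _ x => ?_⟩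
      simp [Fintype.linearCombination_apply, sub_eq_zero, mul_comm]
    · exact ⟨0, fun h => absurd h hH⟩
  choose g hg using this
  exact ⟨g, hg⟩

theorem aff_cont {d : ℕ} (f : (Fin d → ℝ) →ᵃ[ℝ] ℝ) : Continuous f :=
  f.continuous_of_finiteDimensional

theorem aff_convex {d : ℕ} (f : (Fin d → ℝ) →ᵃ[ℝ] ℝ) (c : ℝ) :
    Convex ℝ {y | 0 < c * f y} := by
  have : {y | 0 < c * f y} = (c • f) ⁻¹' (Set.Ioi 0) := by ext; simp
  rw [this]
  exact (convex_Ioi 0).affine_preimage _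

theorem prec_sign {d : ℕ} (f : (Fin d → ℝ) →ᵃ[ℝ] ℝ) (S : Set (Fin d → ℝ))
    (hS : _root_.IsPreconnected S) (h0 : ∀ z ∈ S, f z ≠ 0) {x y} (hx : x ∈ S) (hy : y ∈ S) :
    0 < f x * f y := by
  have hI := (hS.image f (aff_cont f).continuousOn).ordConnected
  have h1 : (0:ℝ) ∉ f '' S := by rintro ⟨z, hz, h⟩; exact h0 z hz h
  have hx' := h0 x hx
  have hy' := h0 y hy
  rcases lt_or_gt_of_ne hx' with hx1 | hx1 <;> rcases lt_or_gt_of_ne hy' with hy1 | hy1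
  · exact mul_pos_of_neg_of_neg hx1 hy1
  · exact absurd (hI.out ⟨x, hx, rfl⟩ ⟨y, hy, rfl⟩ ⟨hx1.le, hy1.le⟩) h1
  · exact absurd (hI.out ⟨y, hy, rfl⟩ ⟨x, hx, rfl⟩ ⟨hy1.le, hx1.le⟩) h1
  · exact mul_pos hx1 hy1

theorem sameSide_iff {d : ℕ} (H : Set (Fin d → ℝ)) (f : (Fin d → ℝ) →ᵃ[ℝ] ℝ)
    (hf : ∀ x, x ∈ H ↔ f x = 0) {x y : Fin d → ℝ} (hx : f x ≠ 0) (hy : f y ≠ 0) :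
    SameSide H x y ↔ 0 < f x * f y := by
  have hxH : x ∈ Hᶜ := fun h => hx ((hf x).1 h)
  have hyH : y ∈ Hᶜ := fun h => hy ((hf y).1 h)
  constructor
  · intro h
    refine prec_sign f (connectedComponentIn Hᶜ x) isPreconnected_connectedComponentIn ?_
      (mem_connectedComponentIn hxH) (by rw [h]; exact mem_connectedComponentIn hyH)
    intro z hz h0
    exact connectedComponentIn_subset _ _ hz ((hf z).2 h0)
  · intro h
    refine connectedComponentIn_eq ?_
    refine (aff_convex f (f x)).isPreconnected.subset_connectedComponentIn
      (mul_self_pos.2 hx) ?_ h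
    intro z hz hzH
    rw [Set.mem_ofPred_eq, (hf z).1 hzH] at hz
    simp at hz

theorem comp_eq {d : ℕ} {𝒜 : Finset (Set (Fin d → ℝ))}
    {g} (hg : DefFun 𝒜 g) {x : Fin d → ℝ} (hx : ∀ H ∈ 𝒜, g H x ≠ 0) :
    connectedComponentIn (ArrUnion 𝒜)ᶜ x = {y | ∀ H ∈ 𝒜, 0 < g H x * g H y} := by
  have hmem : ∀ z, z ∈ (ArrUnion 𝒜)ᶜ ↔ ∀ H ∈ 𝒜, g H z ≠ 0 := by
    intro z
    simp only [ArrUnion, Set.mem_compl_iff, Set.mem_iUnion, not_exists]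
    exact forall₂_congr fun H hH => not_congr (hg H hH z)
  apply Set.Subset.antisymm
  · intro y hy H hH
    refine prec_sign (g H) _ isPreconnected_connectedComponentIn ?_
      (mem_connectedComponentIn ((hmem x).2 hx)) hy
    intro z hz
    exact (hmem z).1 (connectedComponentIn_subset _ _ hz) H hH
  · have : {y | ∀ H ∈ 𝒜, 0 < g H x * g H y} = ⋂ H ∈ 𝒜, {y | 0 < g H x * g H y} := by
      ext; simp
    refine _root_.IsPreconnected.subset_connectedComponentIn ?_ ?_ ?_
    · rw [this]
      exact (convex_iInter₂ fun H _ => aff_convex (g H) (g H x)).isPreconnected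
    · exact fun H hH => mul_self_pos.2 (hx H hH)
    · intro z hz
      refine (hmem z).2 fun H hH h0 => ?_
      have := hz H hH
      simp [h0] at this

theorem pos_trans {a b c : ℝ} (h1 : 0 < a * b) : 0 < a * c ↔ 0 < b * c := by
  rcases pos_and_pos_or_neg_and_neg_of_mul_pos h1 with ⟨h, h'⟩ | ⟨h, h'⟩
  · rw [mul_pos_iff_of_pos_left h, mul_pos_iff_of_pos_left h']
  · rw [← neg_mul_neg a, ← neg_mul_neg b, mul_pos_iff_of_pos_left (neg_pos.2 h),
      mul_pos_iff_of_pos_left (neg_pos.2 h')]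

theorem chamber_ne {d : ℕ} {𝒜 : Finset (Set (Fin d → ℝ))}
    {g} (hg : DefFun 𝒜 g) {C : Set (Fin d → ℝ)} (hC : IsChamber 𝒜 C) {y} (hy : y ∈ C) :
    ∀ H ∈ 𝒜, g H y ≠ 0 := by
  obtain ⟨x, hx, rfl⟩ := hC
  intro H hH h0
  apply connectedComponentIn_subset _ _ hy
  simp only [ArrUnion, Set.mem_iUnion]
  exact ⟨H, hH, (hg H hH y).2 h0⟩

theorem chamber_eq {d : ℕ} {𝒜 : Finset (Set (Fin d → ℝ))}
    {g} (hg : DefFun 𝒜 g) {C : Set (Fin d → ℝ)} (hC : IsChamber 𝒜 C) {x} (hx : x ∈ C) :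
    C = {y | ∀ H ∈ 𝒜, 0 < g H x * g H y} := by
  have hne := chamber_ne hg hC hx
  obtain ⟨x0, hx0, rfl⟩ := hC
  rw [connectedComponentIn_eq hx]
  exact comp_eq hg hne

theorem chamber_nonempty {d : ℕ} {𝒜 : Finset (Set (Fin d → ℝ))}
    {C : Set (Fin d → ℝ)} (hC : IsChamber 𝒜 C) : ∃ x, x ∈ C := by
  obtain ⟨x0, hx0, rfl⟩ := hC
  exact ⟨x0, mem_connectedComponentIn hx0⟩

theorem chamber_of {d : ℕ} {𝒜 : Finset (Set (Fin d → ℝ))}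
    {g} (hg : DefFun 𝒜 g) {x} (hx : ∀ H ∈ 𝒜, g H x ≠ 0) :
    ∃ C, IsChamber 𝒜 C ∧ x ∈ C := by
  have : x ∉ ArrUnion 𝒜 := by
    simp only [ArrUnion, Set.mem_iUnion, not_exists]
    exact fun H hH h => hx H hH ((hg H hH x).1 h)
  exact ⟨_, ⟨x, this, rfl⟩, mem_connectedComponentIn this⟩

theorem sep_iff {d : ℕ} {𝒜 : Finset (Set (Fin d → ℝ))}
    {g} (hg : DefFun 𝒜 g) {A B : Set (Fin d → ℝ)} (hA : IsChamber 𝒜 A) (hB : IsChamber 𝒜 B)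
    {x y} (hx : x ∈ A) (hy : y ∈ B) {H} (hH : H ∈ 𝒜) :
    Separates H A B ↔ ¬ 0 < g H x * g H y := by
  constructor
  · rintro ⟨x', hx', y', hy', -, -, h⟩ h1
    apply h
    rw [sameSide_iff H (g H) (hg H hH) (chamber_ne hg hA hx' H hH) (chamber_ne hg hB hy' H hH)]
    rw [chamber_eq hg hA hx] at hx'
    rw [chamber_eq hg hB hy] at hy'
    rw [← pos_trans (hx' H hH), mul_comm, ← pos_trans (hy' H hH), mul_comm]
    exact h1
  · intro h
    have h1 := chamber_ne hg hA hx H hH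
    have h2 := chamber_ne hg hB hy H hH
    refine ⟨x, hx, y, hy, fun h => h1 ((hg H hH x).1 h), fun h => h2 ((hg H hH y).1 h), ?_⟩
    rwa [sameSide_iff H (g H) (hg H hH) h1 h2]

/-- The set of separating hyperplanes. -/
def sepSet {d : ℕ} (𝒜 : Finset (Set (Fin d → ℝ))) (A B : Set (Fin d → ℝ)) :
    Finset (Set (Fin d → ℝ)) := 𝒜.filter (fun H => Separates H A B)

theorem mem_sepSet {d : ℕ} {𝒜 : Finset (Set (Fin d → ℝ))}
    {g} (hg : DefFun 𝒜 g) {A B : Set (Fin d → ℝ)} (hA : IsChamber 𝒜 A) (hB : IsChamber 𝒜 B)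
    {x y} (hx : x ∈ A) (hy : y ∈ B) {H} :
    H ∈ sepSet 𝒜 A B ↔ H ∈ 𝒜 ∧ ¬ 0 < g H x * g H y := by
  simp only [sepSet, Finset.mem_filter]
  exact and_congr_right fun hH => sep_iff hg hA hB hx hy hH

theorem adj_iff {d : ℕ} {𝒜 : Finset (Set (Fin d → ℝ))} {A B : Set (Fin d → ℝ)} :
    Adjacent 𝒜 A B ↔ (sepSet 𝒜 A B).card = 1 := by
  rw [Finset.card_eq_one, Adjacent]
  simp only [ExistsUnique, Finset.eq_singleton_iff_unique_mem, sepSet, Finset.mem_filter]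

theorem not_pos_split {a b c : ℝ} (h : ¬ 0 < a * c) (hb : b ≠ 0) :
    ¬ 0 < a * b ∨ ¬ 0 < b * c := by
  by_contra! h'
  exact h ((pos_trans h'.1).2 h'.2)

theorem sep_tri {d : ℕ} {𝒜 : Finset (Set (Fin d → ℝ))}
    {g} (hg : DefFun 𝒜 g) {A B M : Set (Fin d → ℝ)} (hA : IsChamber 𝒜 A) (hB : IsChamber 𝒜 B)
    (hM : IsChamber 𝒜 M) : sepSet 𝒜 A B ⊆ sepSet 𝒜 A M ∪ sepSet 𝒜 M B := by
  obtain ⟨x, hx⟩ := chamber_nonempty hA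
  obtain ⟨y, hy⟩ := chamber_nonempty hB
  obtain ⟨z, hz⟩ := chamber_nonempty hM
  intro H hH
  rw [mem_sepSet hg hA hB hx hy] at hH
  rw [Finset.mem_union, mem_sepSet hg hA hM hx hz, mem_sepSet hg hM hB hz hy]
  rcases not_pos_split hH.2 (chamber_ne hg hM hz H hH.1) with h | h
  · exact Or.inl ⟨hH.1, h⟩
  · exact Or.inr ⟨hH.1, h⟩

theorem sep_self {d : ℕ} {𝒜 : Finset (Set (Fin d → ℝ))}
    {g} (hg : DefFun 𝒜 g) {A : Set (Fin d → ℝ)} (hA : IsChamber 𝒜 A) : sepSet 𝒜 A A = ∅ := by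
  obtain ⟨x, hx⟩ := chamber_nonempty hA
  ext H
  rw [mem_sepSet hg hA hA hx hx]
  simp only [Finset.notMem_empty, iff_false, not_and, not_not]
  exact fun hH => mul_self_pos.2 (chamber_ne hg hA hx H hH)

theorem walk_lower {d : ℕ} {𝒜 : Finset (Set (Fin d → ℝ))} {g} (hg : DefFun 𝒜 g) :
    ∀ (l : List ((chamberGraph 𝒜).E × Bool)) (v : (chamberGraph 𝒜).V),
      (chamberGraph 𝒜).WalkFrom v l → (∀ s ∈ l, s.2 = true) →
      (sepSet 𝒜 v.1 ((chamberGraph 𝒜).walkEnd v l).1).card ≤ l.length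
  | [], v, _, _ => by
      show (sepSet 𝒜 v.1 v.1).card ≤ 0
      rw [sep_self hg v.2]; simp
  | (e, b) :: l, v, h, hp => by
      have hb : b = true := hp (e, b) (by simp)
      subst hb
      obtain ⟨h1, h2⟩ := h
      have ih := walk_lower hg l _ h2 (fun s hs => hp s (by simp [hs]))
      have h3 : (sepSet 𝒜 e.1.1.1 e.1.2.1).card = 1 := adj_iff.1 e.2
      subst h1
      show (sepSet 𝒜 e.1.1.1 ((chamberGraph 𝒜).walkEnd e.1.2 l).1).card ≤ l.length + 1
      have h4 := Finset.card_le_card (sep_tri hg e.1.1.2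
        ((chamberGraph 𝒜).walkEnd e.1.2 l).2 e.1.2.2)
      have h5 := h4.trans (Finset.card_union_le _ _)
      have ih' : (sepSet 𝒜 e.1.2.1 ((chamberGraph 𝒜).walkEnd e.1.2 l).1).card ≤ l.length := ih
      omega

theorem small_sign {d : ℕ} (f : (Fin d → ℝ) →ᵃ[ℝ] ℝ) (x y : Fin d → ℝ) (hx : f x ≠ 0) :
    ∀ᶠ ε in nhdsWithin (0:ℝ) (Set.Ioi 0), 0 < f x * f (AffineMap.lineMap x y ε) := by
  apply Filter.Eventually.filter_mono nhdsWithin_le_nhds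
  have hc : Continuous (fun ε : ℝ => f x * f (AffineMap.lineMap x y ε)) :=
    continuous_const.mul ((aff_cont f).comp AffineMap.lineMap_continuous)
  refine hc.continuousAt.eventually (IsOpen.mem_nhds isOpen_Ioi ?_)
  simpa using hx

theorem line_val {d : ℕ} (f : (Fin d → ℝ) →ᵃ[ℝ] ℝ) (x y : Fin d → ℝ) (t : ℝ) :
    f (AffineMap.lineMap x y t) = (1 - t) * f x + t * f y := by
  rw [f.apply_lineMap, AffineMap.lineMap_apply_ring]

/-- Choose a point of `A` from which `H₁` and `H₂` are crossed at different times. -/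
theorem generic {d : ℕ} {𝒜 : Finset (Set (Fin d → ℝ))} {g} (hg : DefFun 𝒜 g)
    {A : Set (Fin d → ℝ)} (hA : IsChamber 𝒜 A) {H₁ H₂} (h1 : H₁ ∈ 𝒜) (h2 : H₂ ∈ 𝒜)
    (hne : H₁ ≠ H₂) {y} (hy1 : g H₁ y ≠ 0) (hy2 : g H₂ y ≠ 0) :
    ∃ x ∈ A, g H₁ x * g H₂ y ≠ g H₂ x * g H₁ y := by
  have hz : ∃ z, g H₁ z * g H₂ y ≠ g H₂ z * g H₁ y := by
    by_contra! h
    apply hne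
    ext z
    rw [hg H₁ h1, hg H₂ h2]
    have := h z
    constructor
    · intro h0
      rw [h0, zero_mul] at this
      exact (mul_eq_zero.1 this.symm).resolve_right hy1
    · intro h0
      rw [h0, zero_mul] at this
      exact (mul_eq_zero.1 this).resolve_right hy2
  obtain ⟨z, hz⟩ := hz
  obtain ⟨x, hx⟩ := chamber_nonempty hA
  by_cases hgx : g H₁ x * g H₂ y ≠ g H₂ x * g H₁ y
  · exact ⟨x, hx, hgx⟩
  push Not at hgx
  have hev : ∀ᶠ ε in nhdsWithin (0:ℝ) (Set.Ioi 0), ∀ H ∈ 𝒜,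
      0 < g H x * g H (AffineMap.lineMap x z ε) :=
    (Filter.eventually_all_finset 𝒜).2 fun H hH =>
      small_sign (g H) x z (chamber_ne hg hA hx H hH)
  obtain ⟨ε, hε, hε0⟩ := (hev.and self_mem_nhdsWithin).exists
  refine ⟨AffineMap.lineMap x z ε, ?_, ?_⟩
  · rw [chamber_eq hg hA hx]; exact hε
  · rw [line_val, line_val]
    intro h
    apply hz
    have : ε * (g H₁ z * g H₂ y) = ε * (g H₂ z * g H₁ y) := by linear_combination h - (1-ε) * hgx
    exact mul_left_cancel₀ (ne_of_gt hε0) this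

theorem between {a b t : ℝ} (ht0 : 0 < t) (ht1 : t < 1) (hab : 0 < a * b) :
    0 < a * ((1 - t) * a + t * b) := by
  have : a ≠ 0 := by rintro rfl; simp at hab
  have := mul_self_pos.2 this
  have h1 : 0 < 1 - t := by linarith
  have := mul_pos h1 this
  have := mul_pos ht0 hab
  nlinarith

/-- A chamber strictly between. -/
theorem exists_mid {d : ℕ} {𝒜 : Finset (Set (Fin d → ℝ))} {g} (hg : DefFun 𝒜 g)
    {A B : Set (Fin d → ℝ)} (hA : IsChamber 𝒜 A) (hB : IsChamber 𝒜 B)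
    (hc : 1 < (sepSet 𝒜 A B).card) :
    ∃ M, IsChamber 𝒜 M ∧ (sepSet 𝒜 A M).card + (sepSet 𝒜 M B).card ≤ (sepSet 𝒜 A B).card ∧
      (sepSet 𝒜 A M).Nonempty ∧ (sepSet 𝒜 M B).Nonempty := by
  obtain ⟨H₁, hH1, H₂, hH2, hne⟩ := Finset.one_lt_card.1 hc
  obtain ⟨y, hy⟩ := chamber_nonempty hB
  have hm : ∀ {H}, H ∈ sepSet 𝒜 A B → H ∈ 𝒜 := fun h => (Finset.mem_filter.1 h).1
  obtain ⟨x, hx, hgx⟩ := generic hg hA (hm hH1) (hm hH2) hne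
    (chamber_ne hg hB hy _ (hm hH1)) (chamber_ne hg hB hy _ (hm hH2))
  -- crossing times
  let τ : Set (Fin d → ℝ) → ℝ := fun H => g H x / (g H x - g H y)
  have key : ∀ H ∈ sepSet 𝒜 A B, g H x * g H y < 0 := by
    intro H hH
    rw [mem_sepSet hg hA hB hx hy] at hH
    exact lt_of_le_of_ne (not_lt.1 hH.2)
      (mul_ne_zero (chamber_ne hg hA hx _ hH.1) (chamber_ne hg hB hy _ hH.1))
  have hτ : ∀ H ∈ sepSet 𝒜 A B, 0 < τ H ∧ τ H < 1 ∧
      (∀ t, g H x * g H (AffineMap.lineMap x y t) = (g H x * (g H x - g H y)) * (τ H - t)) ∧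
      0 < g H x * (g H x - g H y) := by
    intro H hH
    have hk := key H hH
    have hx2 : 0 ≤ g H x * g H x := mul_self_nonneg _
    have hy2 : 0 ≤ g H y * g H y := mul_self_nonneg _
    have hx0 : g H x ≠ 0 := by intro h; simp [h] at hk
    have hy0 : g H y ≠ 0 := by intro h; simp [h] at hk
    have hx2 : 0 < g H x * g H x := mul_self_pos.2 hx0
    have hy2 : 0 < g H y * g H y := mul_self_pos.2 hy0
    have hd : g H x - g H y ≠ 0 := by
      intro h
      rw [sub_eq_zero.1 h] at hk
      linarith
    have hd2 : 0 < (g H x - g H y) * (g H x - g H y) := mul_self_pos.2 hd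
    have hp : 0 < g H x * (g H x - g H y) := by nlinarith
    have e1 : τ H = g H x * (g H x - g H y) / ((g H x - g H y) * (g H x - g H y)) := by
      simp only [τ]; field_simp
    refine ⟨?_, ?_, ?_, hp⟩
    · rw [e1]; exact div_pos hp hd2
    · rw [e1, div_lt_one hd2]; nlinarith
    · intro t
      rw [line_val]
      simp only [τ]
      field_simp
      ring
  have hττ : τ H₁ ≠ τ H₂ := by
    intro h
    have hd1 : g H₁ x - g H₁ y ≠ 0 := by
      intro h0; have := (hτ H₁ hH1).2.2.2; simp [h0] at this
    have hd2 : g H₂ x - g H₂ y ≠ 0 := by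
      intro h0; have := (hτ H₂ hH2).2.2.2; simp [h0] at this
    simp only [τ] at h
    rw [div_eq_div_iff hd1 hd2] at h
    apply hgx
    linarith
  -- order them
  obtain ⟨K₁, K₂, hK1, hK2, hlt⟩ : ∃ K₁ K₂, K₁ ∈ sepSet 𝒜 A B ∧ K₂ ∈ sepSet 𝒜 A B ∧
      τ K₁ < τ K₂ := by
    rcases lt_or_gt_of_ne hττ with h | h
    · exact ⟨_, _, hH1, hH2, h⟩
    · exact ⟨_, _, hH2, hH1, h⟩
  obtain ⟨t, ht, htn⟩ := ((Set.Ioo_infinite hlt).sdiff (𝒜.image τ).finite_toSet).nonempty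
  have ht0 : 0 < t := (hτ K₁ hK1).1.trans ht.1
  have ht1 : t < 1 := ht.2.trans (hτ K₂ hK2).2.1
  have hsame : ∀ H ∈ 𝒜, H ∉ sepSet 𝒜 A B → 0 < g H x * g H y := by
    intro H hH hn
    rw [mem_sepSet hg hA hB hx hy] at hn
    by_contra h'
    exact hn ⟨hH, h'⟩
  have hnz : ∀ H ∈ 𝒜, g H (AffineMap.lineMap x y t) ≠ 0 := by
    intro H hH h0
    by_cases hs : H ∈ sepSet 𝒜 A B
    · have h3 := (hτ H hs).2.2.1 t
      rw [h0, mul_zero] at h3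
      have h4 := (mul_eq_zero.1 h3.symm).resolve_left (ne_of_gt (hτ H hs).2.2.2)
      apply htn
      simp only [Finset.coe_image, Set.mem_image, Finset.mem_coe]
      exact ⟨H, hH, by linarith⟩
    · have h3 := between ht0 ht1 (hsame H hH hs)
      rw [← line_val, h0] at h3
      simp at h3
  obtain ⟨M, hM, hzM⟩ := chamber_of hg hnz
  refine ⟨M, hM, ?_, ⟨K₁, ?_⟩, ⟨K₂, ?_⟩⟩
  · have hdis : Disjoint (sepSet 𝒜 A M) (sepSet 𝒜 M B) := by
      rw [Finset.disjoint_left]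
      intro H ha hb
      rw [mem_sepSet hg hA hM hx hzM] at ha
      rw [mem_sepSet hg hM hB hzM hy] at hb
      rw [line_val] at ha hb
      have hxx := mul_self_pos.2 (chamber_ne hg hA hx H ha.1)
      have hyy := mul_self_pos.2 (chamber_ne hg hB hy H ha.1)
      by_cases hs : H ∈ sepSet 𝒜 A B
      · have hk := key H hs
        have hz := hnz H ha.1
        rw [line_val] at hz
        have e1 := lt_of_le_of_ne (not_lt.1 ha.2) (mul_ne_zero (chamber_ne hg hA hx H ha.1) hz)
        have e2 := lt_of_le_of_ne (not_lt.1 hb.2) (mul_ne_zero hz (chamber_ne hg hB hy H ha.1))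
        have := mul_pos_of_neg_of_neg e1 e2
        have h5 := mul_neg_of_neg_of_pos hk (mul_self_pos.2 hz)
        nlinarith
      · exact ha.2 (between ht0 ht1 (hsame H ha.1 hs))
    rw [← Finset.card_union_of_disjoint hdis]
    apply Finset.card_le_card
    intro H hH
    by_contra hs
    have hHA : H ∈ 𝒜 := by
      rcases Finset.mem_union.1 hH with h | h <;> exact (Finset.mem_filter.1 h).1
    have h3 := between ht0 ht1 (hsame H hHA hs)
    rw [← line_val] at h3
    rcases Finset.mem_union.1 hH with h | h
    · rw [mem_sepSet hg hA hM hx hzM] at h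
      exact h.2 h3
    · rw [mem_sepSet hg hM hB hzM hy] at h
      exact h.2 ((pos_trans h3).1 (hsame H hHA hs))
  · rw [mem_sepSet hg hA hM hx hzM]
    refine ⟨hm hK1, ?_⟩
    rw [(hτ K₁ hK1).2.2.1 t]
    have := (hτ K₁ hK1).2.2.2
    have := ht.1
    nlinarith
  · rw [mem_sepSet hg hM hB hzM hy]
    refine ⟨hm hK2, ?_⟩
    have h3 : 0 < g K₂ x * g K₂ (AffineMap.lineMap x y t) := by
      rw [(hτ K₂ hK2).2.2.1 t]
      exact mul_pos (hτ K₂ hK2).2.2.2 (sub_pos.2 ht.2)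
    rw [← pos_trans h3]
    exact not_lt.2 (key K₂ hK2).le

theorem walk_upper {d : ℕ} {𝒜 : Finset (Set (Fin d → ℝ))} {g} (hg : DefFun 𝒜 g) :
    ∀ (n : ℕ) (A B : (chamberGraph 𝒜).V), (sepSet 𝒜 A.1 B.1).card ≤ n →
      ∃ l : List ((chamberGraph 𝒜).E × Bool), (chamberGraph 𝒜).WalkFrom A l ∧
        (∀ s ∈ l, s.2 = true) ∧ (chamberGraph 𝒜).walkEnd A l = B ∧
        l.length ≤ (sepSet 𝒜 A.1 B.1).card := by
  intro n
  induction n with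
  | zero =>
    intro A B h
    have h0 : sepSet 𝒜 A.1 B.1 = ∅ := Finset.card_eq_zero.1 (Nat.le_zero.1 h)
    refine ⟨[], trivial, by simp, ?_, by simp⟩
    show A = B
    apply Subtype.ext
    obtain ⟨x, hx⟩ := chamber_nonempty A.2
    obtain ⟨y, hy⟩ := chamber_nonempty B.2
    have hyA : y ∈ A.1 := by
      rw [chamber_eq hg A.2 hx]
      intro H hH
      by_contra hn
      have := (mem_sepSet hg A.2 B.2 hx hy).2 ⟨hH, hn⟩
      rw [h0] at this
      simp at this
    rw [chamber_eq hg A.2 hyA, chamber_eq hg B.2 hy]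
  | succ n ih =>
    intro A B h
    rcases Nat.lt_or_ge (sepSet 𝒜 A.1 B.1).card (n + 1) with h1 | h1
    · exact ih A B (by omega)
    rcases Nat.lt_or_ge 1 (sepSet 𝒜 A.1 B.1).card with h2 | h2
    · obtain ⟨M, hM, hc, hn1, hn2⟩ := exists_mid hg A.2 B.2 h2
      have hn1' := hn1.card_pos
      have hn2' := hn2.card_pos
      obtain ⟨l1, a1, a2, a3, a4⟩ := ih A ⟨M, hM⟩ (by dsimp only; omega)
      obtain ⟨l2, b1, b2, b3, b4⟩ := ih ⟨M, hM⟩ B (by dsimp only; omega)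
      refine ⟨l1 ++ l2, (chamberGraph 𝒜).walkFrom_append _ _ _ a1 (by rw [a3]; exact b1), ?_, ?_, ?_⟩
      · intro s hs
        rcases List.mem_append.1 hs with h | h
        · exact a2 s h
        · exact b2 s h
      · rw [(chamberGraph 𝒜).walkEnd_append, a3, b3]
      · rw [List.length_append]
        dsimp only at a4 b4
        omega
    · have hadj : Adjacent 𝒜 A.1 B.1 := adj_iff.2 (by omega)
      refine ⟨[(⟨(A, B), hadj⟩, true)], ⟨rfl, trivial⟩, by simp, rfl, ?_⟩
      simp only [List.length_singleton]
      omega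

theorem minPos_le {d : ℕ} {𝒜 : Finset (Set (Fin d → ℝ))} {g} (hg : DefFun 𝒜 g)
    (w : GWalk (chamberGraph 𝒜)) (hw : IsMinPos _ w) :
    w.length ≤ (sepSet 𝒜 w.start.1 w.endV.1).card := by
  obtain ⟨l, h1, h2, h3, h4⟩ := walk_upper hg _ w.start w.endV le_rfl
  exact (hw.2 ⟨w.start, l, h1⟩ rfl h3 h2).trans h4

theorem face_sep {d : ℕ} {𝒜 : Finset (Set (Fin d → ℝ))} {g} (hg : DefFun 𝒜 g)
    {F A Q C : Set (Fin d → ℝ)} (hF : F ∈ Faces 𝒜) (hA : IsChamber 𝒜 A) (hQ : IsChamber 𝒜 Q)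
    (hC : IsChamber 𝒜 C) (hFC : FaceGE F C) (hcomp : CompProp F A Q) :
    (sepSet 𝒜 A Q).card + (sepSet 𝒜 Q C).card ≤ (sepSet 𝒜 A C).card := by
  obtain ⟨p, rfl⟩ := hF
  have hp : p ∈ faceOf 𝒜 p := fun H _ => ⟨Iff.rfl, fun _ => rfl⟩
  obtain ⟨y, hy⟩ := chamber_nonempty hA
  obtain ⟨c, hc⟩ := chamber_nonempty hC
  obtain ⟨q, hq⟩ := chamber_nonempty hQ
  obtain ⟨ε₀, hε₀, hε⟩ := hcomp p hp y hy
  have hline : ∀ ε : ℝ, p + ε • (y - p) = AffineMap.lineMap p y ε := by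
    intro ε; rw [AffineMap.lineMap_apply_module']; abel
  have hev : ∀ᶠ ε in nhdsWithin (0:ℝ) (Set.Ioi 0), AffineMap.lineMap p y ε ∈ Q ∧ 0 < ε := by
    filter_upwards [Ioo_mem_nhdsGT hε₀] with ε h
    rw [← hline]
    exact ⟨hε ε h.1 h.2, h.1⟩
  have main : ∀ H ∈ 𝒜, 0 < g H y * g H q ∨ 0 < g H q * g H c := by
    intro H hH
    by_cases h0 : g H p = 0
    · left
      obtain ⟨ε, hQε, hpos⟩ := hev.exists
      rw [chamber_eq hg hQ hq] at hQε
      have := hQε H hH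
      rw [line_val, h0] at this
      have h2 : 0 < ε * (g H y * g H q) := by linarith
      exact (mul_pos_iff_of_pos_left hpos).1 h2
    · right
      obtain ⟨ε, ⟨hQε, -⟩, h3⟩ := (hev.and (small_sign (g H) p y h0)).exists
      rw [chamber_eq hg hQ hq] at hQε
      have h4 := hQε H hH
      have hpc : p ∈ closure C := hFC (subset_closure hp)
      have hopen : IsOpen {z | 0 < g H p * g H z} :=
        isOpen_lt continuous_const (continuous_const.mul (aff_cont (g H)))
      obtain ⟨z, hz1, hz2⟩ := mem_closure_iff.1 hpc _ hopen (mul_self_pos.2 h0)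
      rw [chamber_eq hg hC hc] at hz2
      have h5 := hz2 H hH
      have hz1 : 0 < g H p * g H z := hz1
      -- signs: p ~ line, q ~ line, p ~ z, c ~ z
      rw [pos_trans h4, ← pos_trans h3, mul_comm, pos_trans h5, mul_comm]
      exact hz1
  have hmA : ∀ {H}, H ∈ sepSet 𝒜 A Q ↔ _ := mem_sepSet hg hA hQ hy hq
  have hdis : Disjoint (sepSet 𝒜 A Q) (sepSet 𝒜 Q C) := by
    rw [Finset.disjoint_left]
    intro H h1 h2
    rw [mem_sepSet hg hA hQ hy hq] at h1
    rw [mem_sepSet hg hQ hC hq hc] at h2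
    exact (main H h1.1).elim h1.2 h2.2
  rw [← Finset.card_union_of_disjoint hdis]
  apply Finset.card_le_card
  intro H hH
  rw [mem_sepSet hg hA hC hy hc]
  rcases Finset.mem_union.1 hH with h | h
  · rw [mem_sepSet hg hA hQ hy hq] at h
    have h2 := (main H h.1).resolve_left h.2
    refine ⟨h.1, ?_⟩
    rw [mul_comm, ← pos_trans h2, mul_comm]
    exact h.2
  · rw [mem_sepSet hg hQ hC hq hc] at h
    have h2 := (main H h.1).resolve_right h.2
    refine ⟨h.1, ?_⟩
    rw [pos_trans h2]
    exact h.2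

/-- Let `F` be a face, `C` a chamber with `F > C`, and `C̄` any chamber.
The concatenation of any positive minimal path from `C̄` to `C̄_F` with any positive minimal
path from `C̄_F` to `C` is a positive minimal path from `C̄` to `C`. -/
theorem statement_5 {d : ℕ} (𝒜 : Finset (Set (Fin d → ℝ))) (h𝒜 : IsArrangement 𝒜)
    (F : Set (Fin d → ℝ)) (hF : F ∈ Faces 𝒜) (C Cbar : (chamberGraph 𝒜).V)
    (hFC : FaceGT F C.1) (w₁ w₂ : GWalk (chamberGraph 𝒜))
    (hw₁s : w₁.start = Cbar) (hw₁e : (w₁.endV).1 = faceComp 𝒜 F Cbar.1)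
    (hw₂s : w₂.start = w₁.endV) (hw₂e : w₂.endV = C)
    (hm₁ : IsMinPos (chamberGraph 𝒜) w₁) (hm₂ : IsMinPos (chamberGraph 𝒜) w₂) :
    IsMinPos (chamberGraph 𝒜) (w₁.append' w₂) := by
  obtain ⟨g, hg⟩ := exists_defFun 𝒜 h𝒜
  have hcomp : CompProp F Cbar.1 w₁.endV.1 := by
    unfold faceComp at hw₁e
    split_ifs at hw₁e with h
    · rw [hw₁e]; exact h.choose_spec.1.2
    · obtain ⟨x, hx⟩ := chamber_nonempty w₁.endV.2
      rw [hw₁e] at hx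
      exact hx.elim
  have hsum := face_sep hg hF Cbar.2 w₁.endV.2 C.2 hFC.1 hcomp
  have l1 := minPos_le hg w₁ hm₁
  have l2 := minPos_le hg w₂ hm₂
  rw [hw₁s] at l1
  rw [hw₂s, hw₂e] at l2
  have happ : w₁.append' w₂ = ⟨w₁.start, w₁.steps ++ w₂.steps,
      (chamberGraph 𝒜).walkFrom_append _ _ _ w₁.valid
        (by rw [show (chamberGraph 𝒜).walkEnd w₁.start w₁.steps = w₂.start from hw₂s.symm]
            exact w₂.valid)⟩ := dif_pos hw₂s.symm
  have hstart : (w₁.append' w₂).start = Cbar := by rw [happ]; exact hw₁s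
  have hend : (w₁.append' w₂).endV = C := by
    rw [happ, ← hw₂e]
    show (chamberGraph 𝒜).walkEnd w₁.start (w₁.steps ++ w₂.steps) = _
    rw [(chamberGraph 𝒜).walkEnd_append]
    rw [show (chamberGraph 𝒜).walkEnd w₁.start w₁.steps = w₂.start from hw₂s.symm]
    rfl
  have hlen : (w₁.append' w₂).length = w₁.length + w₂.length := by
    rw [happ]; exact List.length_append
  refine ⟨?_, ?_⟩
  · rw [happ]
    intro s hs
    rcases List.mem_append.1 hs with h | h
    · exact hm₁.1 s h
    · exact hm₂.1 s h
  · intro w' hs he hp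
    rw [hstart] at hs
    rw [hend] at he
    have h3 := walk_lower hg w'.steps w'.start w'.valid hp
    rw [show (chamberGraph 𝒜).walkEnd w'.start w'.steps = C from he, hs] at h3
    rw [hlen]
    exact (Nat.add_le_add l1 l2).trans (hsum.trans h3)

end
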